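/- arXiv:2410.23951 — 2 statements merged into one kernel-verified Lean document; each statement's English description precedes it below -/
import Mathlib

section
/- Let D = Spec k'[[t]] with k' a field, Y a finite type scheme over k', β : D → Y a morphism, and E a bounded-above complex of coherent sheaves on Y. For each integer n, there is a canonical isomorphism Ext^1(L^{1-n}β^*E, O_D) ≅ Ext^n(Lβ^*E, O_D)_{tors}, where tors denotes the torsion submodule over k'[[t]]. In particular, if L^{1-n}β^*E is torsion then the k'-dimension of Ext^n(Lβ^*E, O_D)_{tors} equals dim_{k'} L^{1-n}β^*E, and if additionally L^{-n}β^*E is torsion then Ext^n(Lβ^*E, O_D) is entirely torsion. -/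
set_option maxHeartbeats 1000000
set_option synthInstance.maxHeartbeats 400000

/-! Statement 7.  `D = Spec k'[[t]]`, `β : D → Y`, and `E` a bounded-above complex of
coherent sheaves on `Y`.  The derived pullback `Lβ^*E` is a bounded-above complex `C`
of finitely generated modules over `R = O_D = k'[[t]]`, and
`Ext^n(Lβ^*E, O_D)` is the hyper-Ext group `Hom_{D(R)}(C, R[n])`, computed in the
derived category of `R`-modules; it is an `R`-module via the scalar action of `R`
on `C`.  The statement: there is a canonical isomorphism
`Ext^1(L^{1-n}β^*E, O_D) ≅ Ext^n(Lβ^*E, O_D)_tors`; if `L^{1-n}β^*E = H^{1-n}(C)` is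
torsion then `dim_{k'} Ext^n(Lβ^*E, O_D)_tors = dim_{k'} L^{1-n}β^*E`; and if moreover
`L^{-n}β^*E = H^{-n}(C)` is torsion then `Ext^n(Lβ^*E, O_D)` is entirely torsion. -/

open CategoryTheory

noncomputable section

variable (k' : Type) [Field k'] [HasDerivedCategory (ModuleCat (PowerSeries k'))]

local notation "R" => PowerSeries k'

/-- Hyper-Ext: `Ext^n(C, O_D) = Hom_{D(R)}(C, R[n])` in the derived category. -/
abbrev hyperExt (C : CochainComplex (ModuleCat R) ℤ) (n : ℤ) : Type _ :=
  DerivedCategory.Q.obj C ⟶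
    (DerivedCategory.Q.obj
      ((CochainComplex.singleFunctor (ModuleCat R) 0).obj (ModuleCat.of R R)))⟦n⟧

instance (C : CochainComplex (ModuleCat R) ℤ) (n : ℤ) : SMul R (hyperExt k' C n) :=
  ⟨fun r x => DerivedCategory.Q.map (r • 𝟙 C) ≫ x⟩

/-- The `R = k'[[t]]`-module structure on hyper-Ext, given by precomposition with
the scalar endomorphisms of the complex `C`. -/
noncomputable instance (C : CochainComplex (ModuleCat R) ℤ) (n : ℤ) :
    Module R (hyperExt k' C n) where
  one_smul x := by
    show DerivedCategory.Q.map ((1 : R) • 𝟙 C) ≫ x = x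
    rw [one_smul, DerivedCategory.Q.map_id, Category.id_comp]
  mul_smul r s x := by
    show DerivedCategory.Q.map ((r * s) • 𝟙 C) ≫ x =
      DerivedCategory.Q.map (r • 𝟙 C) ≫ (DerivedCategory.Q.map (s • 𝟙 C) ≫ x)
    rw [← Category.assoc, ← DerivedCategory.Q.map_comp, Linear.smul_comp, Linear.comp_smul,
      Category.comp_id, smul_smul]
  smul_zero r := by
    show DerivedCategory.Q.map (r • 𝟙 C) ≫ 0 = 0
    simp
  smul_add r x y := by
    show DerivedCategory.Q.map (r • 𝟙 C) ≫ (x + y) =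
      DerivedCategory.Q.map (r • 𝟙 C) ≫ x + DerivedCategory.Q.map (r • 𝟙 C) ≫ y
    rw [Preadditive.comp_add]
  add_smul r s x := by
    show DerivedCategory.Q.map ((r + s) • 𝟙 C) ≫ x =
      DerivedCategory.Q.map (r • 𝟙 C) ≫ x + DerivedCategory.Q.map (s • 𝟙 C) ≫ x
    rw [add_smul, Functor.map_add, Preadditive.add_comp]
  zero_smul x := by
    show DerivedCategory.Q.map ((0 : R) • 𝟙 C) ≫ x = 0
    rw [zero_smul, Functor.map_zero, Limits.zero_comp]

end

namespace CategoryTheory.Pretriangulated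

open Limits

variable {D : Type*} [Category* D] [HasZeroObject D] [HasShift D ℤ] [Preadditive D]
  [∀ n : ℤ, (shiftFunctor D n).Additive] [Pretriangulated D]

section

variable {X₁ X₂ X₃ : D} {f : X₁ ⟶ X₂} {g : X₂ ⟶ X₃} {δ : X₃ ⟶ X₁⟦(1 : ℤ)⟧}
  {a n : ℤ} {Y : D}

lemma exists_comp_shift_mor₂_iff (hT : Triangle.mk f g δ ∈ distTriang D) (hn : a + 1 = n)
    (y : Y ⟶ X₃⟦a⟧) :
    (∃ x : Y ⟶ X₂⟦a⟧, x ≫ g⟦a⟧' = y) ↔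
      y ≫ δ⟦a⟧' ≫ (shiftFunctorAdd' D 1 a n (by lia)).inv.app X₁ = 0 := by
  have ex := (preadditiveCoyoneda.obj (Opposite.op Y)).homologySequence_exact₃ _ hT a n hn
  have comp := (preadditiveCoyoneda.obj (Opposite.op Y)).comp_homologySequenceδ _ hT a n hn
  rw [ShortComplex.ab_exact_iff] at ex
  have key := fun y ↦ preadditiveCoyoneda_homologySequenceδ_apply
    (Triangle.mk f g δ) a n hn (A := Opposite.op Y) y
  constructor
  · rintro ⟨x, rfl⟩
    exact (key _).symm.trans (ConcreteCategory.congr_hom comp x)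
  · intro h
    exact ex y ((key y).trans h)

lemma exists_comp_shift_connecting_iff (hT : Triangle.mk f g δ ∈ distTriang D) (hn : a + 1 = n)
    (y : Y ⟶ X₁⟦n⟧) :
    (∃ x : Y ⟶ X₃⟦a⟧, x ≫ δ⟦a⟧' ≫ (shiftFunctorAdd' D 1 a n (by lia)).inv.app X₁ = y) ↔
      y ≫ f⟦n⟧' = 0 := by
  have ex := (preadditiveCoyoneda.obj (Opposite.op Y)).homologySequence_exact₁ _ hT a n hn
  have comp := (preadditiveCoyoneda.obj (Opposite.op Y)).homologySequenceδ_comp _ hT a n hn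
  rw [ShortComplex.ab_exact_iff] at ex
  have key := fun y ↦ preadditiveCoyoneda_homologySequenceδ_apply
    (Triangle.mk f g δ) a n hn (A := Opposite.op Y) y
  constructor
  · rintro ⟨x, rfl⟩
    exact (congrArg (fun z : Y ⟶ X₁⟦n⟧ ↦ z ≫ f⟦n⟧') (key x)).symm.trans
      (ConcreteCategory.congr_hom comp x)
  · intro h
    obtain ⟨x, hx⟩ := ex y h
    exact ⟨x, (key x).symm.trans hx⟩

end

end CategoryTheory.Pretriangulated

section DerivedHom

open Limits HomologicalComplex

universe w v u

variable {A : Type u} [Category.{v} A] [Abelian A]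

lemma HomologicalComplex.exists_d_comp_eq_of_iCycles_comp_eq_zero
    (K : CochainComplex A ℤ) (m : ℤ) {J : A} [Injective J] (φ : K.X m ⟶ J)
    (hφ : K.iCycles m ≫ φ = 0) : ∃ ψ : K.X (m + 1) ⟶ J, K.d m (m + 1) ≫ ψ = φ := by
  let T := ShortComplex.mk (K.iCycles m) (K.d m (m + 1)) (by simp)
  have hT : T.Exact := T.exact_of_f_is_kernel (K.cyclesIsKernel m (m + 1) (by simp))
  exact ⟨hT.descToInjective φ hφ, hT.comp_descToInjective φ hφ⟩

lemma HomologicalComplex.exists_homologyMap_comp_eq (K : CochainComplex A ℤ) (m : ℤ)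
    {J : A} [Injective J] (φ : K.homology m ⟶ J) : ∃ g : K ⟶ (single A (.up ℤ) m).obj J,
      homologyMap g m ≫ (singleObjHomologySelfIso (ComplexShape.up ℤ) m J).hom = φ := by
  let ψ := Injective.factorThru φ (K.homologyι m)
  refine ⟨mkHomToSingle (K.pOpcycles m ≫ ψ) (by simp), ?_⟩
  rw [← cancel_epi (K.homologyπ m), homologyπ_naturality_assoc,
    homologyπ_singleObjHomologySelfIso_hom, singleObjCyclesSelfIso_hom, cyclesMap_i_assoc]
  simp [ψ, -homology_π_ι_assoc, ← homology_π_ι_assoc]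

variable [HasDerivedCategory.{w} A]

namespace DerivedCategory

lemma Q_map_eq_zero_of_homologyMap_eq_zero {K : CochainComplex A ℤ} {m : ℤ} {J : A}
    [Injective J] (g : K ⟶ (single A (.up ℤ) m).obj J) (hg : homologyMap g m = 0) :
    Q.map g = 0 := by
  let e := singleObjXSelf (ComplexShape.up ℤ) m J
  have h0 : K.iCycles m ≫ g.f m ≫ e.hom = 0 := by
    have h1 : cyclesMap g m ≫ homologyπ _ m ≫ (singleObjHomologySelfIso _ m J).hom = 0 := by
      rw [← homologyπ_naturality_assoc, hg, zero_comp, comp_zero]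
    rw [homologyπ_singleObjHomologySelfIso_hom, singleObjCyclesSelfIso_hom] at h1
    rw [← cyclesMap_i_assoc]
    exact h1
  obtain ⟨ψ, hψ⟩ := K.exists_d_comp_eq_of_iCycles_comp_eq_zero m _ h0
  let h : ∀ i j, (ComplexShape.up ℤ).Rel j i → (K.X i ⟶ ((single A (.up ℤ) m).obj J).X j) :=
    fun i j hij ↦ if hj : j = m then (K.XIsoOfEq (by subst hj; exact hij.symm)).hom ≫ ψ ≫
      (singleObjXIsoOfEq (ComplexShape.up ℤ) m J j hj).inv else 0
  have hgh : g = Homotopy.nullHomotopicMap' h := by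
    apply to_single_hom_ext
    rw [Homotopy.nullHomotopicMap'_f (k₂ := m - 1) (k₀ := m + 1) (by simp) (by simp)]
    have : h (m + 1) m (by simp) = ψ ≫ e.inv := by
      simp only [h, e, singleObjXSelf, dif_pos, XIsoOfEq_rfl, Iso.refl_hom, Category.id_comp]
    rw [this, reassoc_of% hψ]
    simp
  rw [hgh, ← Q.map_zero]
  exact Q_map_eq_of_homotopy A (Homotopy.nullHomotopy' h)

/-- The cohomology of the image of a complex in the derived category. -/
noncomputable def homologyObjIso (K : CochainComplex A ℤ) (m : ℤ) :
    (homologyFunctor A m).obj (Q.obj K) ≅ K.homology m :=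
  (homologyFunctorFactors A m).app K

lemma homologyObjIso_hom_naturality {K L : CochainComplex A ℤ} (s : K ⟶ L) (m : ℤ) :
    (homologyFunctor A m).map (Q.map s) ≫ (homologyObjIso L m).hom =
      (homologyObjIso K m).hom ≫ homologyMap s m :=
  homologyFunctorFactors_hom_naturality s m

lemma homologyObjIso_hom_naturality_assoc {K L : CochainComplex A ℤ} (s : K ⟶ L) (m : ℤ) {Z : A}
    (g : L.homology m ⟶ Z) :
    (homologyFunctor A m).map (Q.map s) ≫ (homologyObjIso L m).hom ≫ g =
      (homologyObjIso K m).hom ≫ homologyMap s m ≫ g := by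
  rw [← Category.assoc, homologyObjIso_hom_naturality, Category.assoc]

/-- The map on `m`-th cohomology induced by a morphism in the derived category to an object
concentrated in degree `m`. -/
noncomputable def homologyHom (K : CochainComplex A ℤ) (m : ℤ) (J : A) :
    (Q.obj K ⟶ Q.obj ((single A (.up ℤ) m).obj J)) →+ (K.homology m ⟶ J) where
  toFun f := (homologyObjIso K m).inv ≫ (homologyFunctor A m).map f ≫
    (homologyObjIso ((single A (.up ℤ) m).obj J) m).hom ≫
      (singleObjHomologySelfIso (ComplexShape.up ℤ) m J).hom
  map_zero' := by rw [Functor.map_zero, zero_comp, comp_zero]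
  map_add' f g := by rw [Functor.map_add, Preadditive.add_comp, Preadditive.comp_add]

lemma homologyHom_apply {K : CochainComplex A ℤ} {m : ℤ} {J : A}
    (f : Q.obj K ⟶ Q.obj ((single A (.up ℤ) m).obj J)) :
    homologyHom K m J f = (homologyObjIso K m).inv ≫ (homologyFunctor A m).map f ≫
    (homologyObjIso ((single A (.up ℤ) m).obj J) m).hom ≫
      (singleObjHomologySelfIso (ComplexShape.up ℤ) m J).hom := rfl

lemma homologyHom_Q_map {K : CochainComplex A ℤ} {m : ℤ} {J : A}
    (g : K ⟶ (single A (.up ℤ) m).obj J) :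
    homologyHom K m J (Q.map g) =
      homologyMap g m ≫ (singleObjHomologySelfIso (ComplexShape.up ℤ) m J).hom := by
  rw [homologyHom_apply, homologyObjIso_hom_naturality_assoc, Iso.inv_hom_id_assoc]

lemma homologyHom_comp_left {K L : CochainComplex A ℤ} (s : L ⟶ K) {m : ℤ} {J : A}
    (f : Q.obj K ⟶ Q.obj ((single A (.up ℤ) m).obj J)) :
    homologyHom L m J (Q.map s ≫ f) = homologyMap s m ≫ homologyHom K m J f := by
  rw [homologyHom_apply, homologyHom_apply, Iso.inv_comp_eq,
    ← homologyObjIso_hom_naturality_assoc, Functor.map_comp, Iso.hom_inv_id_assoc, Category.assoc]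

lemma homologyHom_comp_right {K : CochainComplex A ℤ} {m : ℤ} {I J : A}
    (f : Q.obj K ⟶ Q.obj ((single A (.up ℤ) m).obj I)) (g : I ⟶ J) :
    homologyHom K m J (f ≫ Q.map ((single A (.up ℤ) m).map g)) = homologyHom K m I f ≫ g := by
  rw [homologyHom_apply, homologyHom_apply, Functor.map_comp, Category.assoc,
    homologyObjIso_hom_naturality_assoc]
  simp only [Category.assoc, singleObjHomologySelfIso_hom_naturality]

lemma homologyHom_bijective (K : CochainComplex A ℤ) (m : ℤ) (J : A) [Injective J] :
    Function.Bijective (homologyHom K m J) := by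
  refine ⟨(injective_iff_map_eq_zero _).2 fun f hf ↦ ?_, fun φ ↦ ?_⟩
  · obtain ⟨L, s, hs, g, rfl⟩ := right_fac f
    have : Q.map g = 0 := by
      apply Q_map_eq_zero_of_homologyMap_eq_zero
      rw [← cancel_mono (singleObjHomologySelfIso (ComplexShape.up ℤ) m J).hom,
        ← homologyHom_Q_map, zero_comp]
      have h := homologyHom_comp_left s (inv (Q.map s) ≫ Q.map g)
      rwa [hf, IsIso.hom_inv_id_assoc, comp_zero] at h
    rw [this, comp_zero]
  · obtain ⟨g, hg⟩ := exists_homologyMap_comp_eq K m φ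
    exact ⟨Q.map g, (homologyHom_Q_map g).trans hg⟩

/-- The shift by `a` of an object in degree `0` is that object in degree `-a`. -/
noncomputable def shiftSingleIso {a m : ℤ} (h : a + m = 0) (J : A) :
    (Q.obj ((single A (.up ℤ) 0).obj J))⟦a⟧ ≅ Q.obj ((single A (.up ℤ) m).obj J) :=
  ((singleFunctors A).shiftIso a m 0 h).app J

lemma shiftSingleIso_hom_naturality {a m : ℤ} (h : a + m = 0) {I J : A} (g : I ⟶ J) :
    (Q.map ((single A (.up ℤ) 0).map g))⟦a⟧' ≫ (shiftSingleIso h J).hom =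
      (shiftSingleIso h I).hom ≫ Q.map ((single A (.up ℤ) m).map g) :=
  ((singleFunctors A).shiftIso a m 0 h).hom.naturality g

/-- The map on `m`-th cohomology induced by a morphism in the derived category to the shift by `a`
of an object concentrated in degree `0`, when `a + m = 0`. -/
noncomputable def shiftedHomologyHom (K : CochainComplex A ℤ) {a m : ℤ} (h : a + m = 0) (J : A) :
    (Q.obj K ⟶ (Q.obj ((single A (.up ℤ) 0).obj J))⟦a⟧) →+ (K.homology m ⟶ J) where
  toFun f := homologyHom K m J (f ≫ (shiftSingleIso h J).hom)
  map_zero' := by rw [zero_comp, map_zero]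
  map_add' f g := by rw [Preadditive.add_comp, map_add]

lemma shiftedHomologyHom_apply {K : CochainComplex A ℤ} {a m : ℤ} (h : a + m = 0) {J : A}
    (f : Q.obj K ⟶ (Q.obj ((single A (.up ℤ) 0).obj J))⟦a⟧) :
    shiftedHomologyHom K h J f = homologyHom K m J (f ≫ (shiftSingleIso h J).hom) := rfl

lemma shiftedHomologyHom_comp_left {K L : CochainComplex A ℤ} (s : L ⟶ K) {a m : ℤ}
    (h : a + m = 0) {J : A} (f : Q.obj K ⟶ (Q.obj ((single A (.up ℤ) 0).obj J))⟦a⟧) :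
    shiftedHomologyHom L h J (Q.map s ≫ f) = homologyMap s m ≫ shiftedHomologyHom K h J f := by
  simp only [shiftedHomologyHom_apply, Category.assoc, homologyHom_comp_left]

lemma shiftedHomologyHom_comp_right {K : CochainComplex A ℤ} {a m : ℤ} (h : a + m = 0) {I J : A}
    (f : Q.obj K ⟶ (Q.obj ((single A (.up ℤ) 0).obj I))⟦a⟧) (g : I ⟶ J) :
    shiftedHomologyHom K h J (f ≫ (Q.map ((single A (.up ℤ) 0).map g))⟦a⟧') =
      shiftedHomologyHom K h I f ≫ g := by
  simp only [shiftedHomologyHom_apply, Category.assoc, shiftSingleIso_hom_naturality]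
  simp only [← Category.assoc, homologyHom_comp_right]

lemma shiftedHomologyHom_bijective (K : CochainComplex A ℤ) {a m : ℤ} (h : a + m = 0) (J : A)
    [Injective J] : Function.Bijective (shiftedHomologyHom K h J) :=
  (homologyHom_bijective K m J).comp (shiftSingleIso h J).homToEquiv.bijective

/-- For an injective object `J`, morphisms in the derived category from a complex `K` to a shift
of `J` are the same as morphisms from the cohomology of `K` to `J`. -/
noncomputable def shiftedHomologyEquiv (K : CochainComplex A ℤ) {a m : ℤ} (h : a + m = 0) (J : A)
    [Injective J] : (Q.obj K ⟶ (Q.obj ((single A (.up ℤ) 0).obj J))⟦a⟧) ≃+ (K.homology m ⟶ J) :=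
  AddEquiv.ofBijective _ (shiftedHomologyHom_bijective K h J)

lemma shiftedHomologyEquiv_symm_comp_left {K L : CochainComplex A ℤ} (s : L ⟶ K) {a m : ℤ}
    (h : a + m = 0) {J : A} [Injective J] (φ : K.homology m ⟶ J) :
    (shiftedHomologyEquiv L h J).symm (homologyMap s m ≫ φ) =
      Q.map s ≫ (shiftedHomologyEquiv K h J).symm φ := by
  rw [AddEquiv.symm_apply_eq]
  refine Eq.trans ?_ (shiftedHomologyHom_comp_left s h _).symm
  exact congrArg _ ((shiftedHomologyEquiv K h J).apply_symm_apply φ).symm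

lemma shiftedHomologyEquiv_symm_comp_right {K : CochainComplex A ℤ} {a m : ℤ} (h : a + m = 0)
    {I J : A} [Injective I] [Injective J] (φ : K.homology m ⟶ I) (g : I ⟶ J) :
    (shiftedHomologyEquiv K h J).symm (φ ≫ g) =
      (shiftedHomologyEquiv K h I).symm φ ≫ (Q.map ((single A (.up ℤ) 0).map g))⟦a⟧' := by
  rw [AddEquiv.symm_apply_eq]
  refine Eq.trans ?_ (shiftedHomologyHom_comp_right h _ _).symm
  exact congrArg (· ≫ g) ((shiftedHomologyEquiv K h I).apply_symm_apply φ).symm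

section

open Pretriangulated

variable (K : CochainComplex A ℤ) {a m n : ℤ} (h : a + m = 0) (hn : a + 1 = n)
  {I J : A} [Injective J] {X : DerivedCategory A}

/-- The composition of the morphism to a shift of an injective object `J` corresponding to
a morphism from a cohomology object to `J`, with a shift of `δ : J ⟶ X⟦1⟧`. -/
noncomputable def connectingHom (δ : Q.obj ((single A (.up ℤ) 0).obj J) ⟶ X⟦(1 : ℤ)⟧) :
    (K.homology m ⟶ J) →+ (Q.obj K ⟶ X⟦n⟧) where
  toFun φ := (shiftedHomologyEquiv K h J).symm φ ≫ δ⟦a⟧' ≫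
    (shiftFunctorAdd' (DerivedCategory A) 1 a n (by lia)).inv.app X
  map_zero' := by rw [map_zero, zero_comp]
  map_add' φ ψ := by rw [map_add, Preadditive.add_comp]

variable {δ : Q.obj ((single A (.up ℤ) 0).obj J) ⟶ X⟦(1 : ℤ)⟧}

lemma connectingHom_apply (φ : K.homology m ⟶ J) :
    connectingHom K h hn δ φ = (shiftedHomologyEquiv K h J).symm φ ≫ δ⟦a⟧' ≫
      (shiftFunctorAdd' _ 1 a n (by lia)).inv.app X := rfl

lemma connectingHom_comp_left {L : CochainComplex A ℤ} (s : L ⟶ K) (φ : K.homology m ⟶ J) :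
    connectingHom L h hn δ (homologyMap s m ≫ φ) = Q.map s ≫ connectingHom K h hn δ φ := by
  rw [connectingHom_apply, connectingHom_apply, shiftedHomologyEquiv_symm_comp_left,
    Category.assoc]

variable {f : X ⟶ Q.obj ((single A (.up ℤ) 0).obj I)} {g : I ⟶ J}

lemma connectingHom_eq_zero_iff [Injective I]
    (hT : Triangle.mk f (Q.map ((single A (.up ℤ) 0).map g)) δ ∈ distTriang _)
    (φ : K.homology m ⟶ J) :
    connectingHom K h hn δ φ = 0 ↔ ∃ ψ : K.homology m ⟶ I, ψ ≫ g = φ := by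
  rw [connectingHom_apply, ← exists_comp_shift_mor₂_iff hT hn,
    (shiftedHomologyEquiv K h I).symm.surjective.exists]
  simp only [← shiftedHomologyEquiv_symm_comp_right, EmbeddingLike.apply_eq_iff_eq]

lemma exists_connectingHom_eq_iff
    (hT : Triangle.mk f (Q.map ((single A (.up ℤ) 0).map g)) δ ∈ distTriang _)
    (x : Q.obj K ⟶ X⟦n⟧) :
    (∃ φ, connectingHom K h hn δ φ = x) ↔ x ≫ f⟦n⟧' = 0 := by
  rw [← exists_comp_shift_connecting_iff hT hn,
    (shiftedHomologyEquiv K h J).symm.surjective.exists]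
  rfl

end

end DerivedCategory

end DerivedHom

section

variable {A : Type*} [CommRing A]

lemma Module.Baer.of_forall_exists_smul_eq [IsPrincipalIdealRing A] {M : Type*} [AddCommGroup M]
    [Module A M] (h : ∀ a : A, a ≠ 0 → ∀ y : M, ∃ x, a • x = y) : Module.Baer A M := by
  intro I g
  obtain ⟨a, rfl⟩ := (IsPrincipalIdealRing.principal I).principal
  obtain ⟨x, hx⟩ : ∃ x : M, a • x = g ⟨a, Submodule.mem_span_singleton_self a⟩ := by
    rcases eq_or_ne a 0 with rfl | ha
    · exact ⟨0, by rw [smul_zero, ← map_zero g]; rfl⟩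
    · exact h a ha _
  refine ⟨LinearMap.toSpanSingleton A M x, fun y hy ↦ ?_⟩
  obtain ⟨b, rfl⟩ := Submodule.mem_span_singleton.1 hy
  rw [LinearMap.toSpanSingleton_apply, smul_assoc, hx, ← map_smul]
  rfl

lemma LinearMap.exists_comp_eq_of_ker_le {M N L : Type*} [AddCommGroup M] [Module A M]
    [AddCommGroup N] [Module A N] [AddCommGroup L] [Module A L] {p : M →ₗ[A] N}
    (hp : Function.Surjective p) (f : M →ₗ[A] L) (h : p.ker ≤ f.ker) :
    ∃ g : N →ₗ[A] L, g ∘ₗ p = f := by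
  refine ⟨p.ker.liftQ f h ∘ₗ (p.quotKerEquivOfSurjective hp).symm.toLinearMap, ?_⟩
  ext x
  have : (p.quotKerEquivOfSurjective hp).symm (p x) = Submodule.Quotient.mk x := by
    rw [LinearEquiv.symm_apply_eq]; rfl
  simp [this]

lemma LinearMap.exists_comp_eq_of_range_le {M N L : Type*} [AddCommGroup M] [Module A M]
    [AddCommGroup N] [Module A N] [AddCommGroup L] [Module A L] {j : M →ₗ[A] N}
    (hj : Function.Injective j) (f : L →ₗ[A] N) (h : f.range ≤ j.range) :
    ∃ g : L →ₗ[A] M, j ∘ₗ g = f := by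
  refine ⟨f.codRestrictOfInjective j hj fun x ↦ h ⟨x, rfl⟩, ?_⟩
  ext x
  simp

/-- Two surjections with the same kernel have isomorphic codomains. -/
noncomputable def LinearMap.equivOfKerEq {M N L : Type*} [AddCommGroup M] [Module A M]
    [AddCommGroup N] [Module A N] [AddCommGroup L] [Module A L] (f : M →ₗ[A] N) (g : M →ₗ[A] L)
    (hf : Function.Surjective f) (hg : Function.Surjective g) (h : f.ker = g.ker) : N ≃ₗ[A] L :=
  (f.quotKerEquivOfSurjective hf).symm ≪≫ₗ Submodule.quotEquivOfEq _ _ h ≪≫ₗ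
    g.quotKerEquivOfSurjective hg

open LinearMap in
/-- Computation of the first cohomology of `Hom(P, N)` by dimension shifting, where `P` is the
start of a resolution of `H` and `N` is embedded in an injective module `I` with quotient `J`. -/
lemma nonempty_linearEquiv_of_resolution
    {P₂ P₁ P₀ H N I J Z E T : Type*}
    [AddCommGroup P₂] [Module A P₂] [AddCommGroup P₁] [Module A P₁] [AddCommGroup P₀] [Module A P₀]
    [AddCommGroup H] [Module A H] [AddCommGroup N] [Module A N] [AddCommGroup I] [Module A I]
    [AddCommGroup J] [Module A J] [AddCommGroup Z] [Module A Z] [AddCommGroup E] [Module A E]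
    [AddCommGroup T] [Module A T] [Module.Projective A P₀]
    {d₂ : P₂ →ₗ[A] P₁} {d₁ : P₁ →ₗ[A] P₀} {ε : P₀ →ₗ[A] H}
    (hd : Function.Exact d₂ d₁) (hd' : Function.Exact d₁ ε) (hε : Function.Surjective ε)
    {j : N →ₗ[A] I} {q : I →ₗ[A] J} (hI : Module.Baer A I)
    (hj : Function.Injective j) (hjq : Function.Exact j q) (hq : Function.Surjective q)
    (ι : Z →ₗ[A] P₁ →ₗ[A] N) (hι : ∀ c, (∃ z, ι z = c) ↔ c ∘ₗ d₂ = 0)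
    (π : Z →ₗ[A] E) (hπ : Function.Surjective π) (hπ₀ : ∀ z, π z = 0 ↔ ∃ χ, χ ∘ₗ d₁ = ι z)
    (Ψ : (H →ₗ[A] J) →ₗ[A] T) (hΨ : Function.Surjective Ψ)
    (hΨ₀ : ∀ θ, Ψ θ = 0 ↔ ∃ ψ, q ∘ₗ ψ = θ) : Nonempty (E ≃ₗ[A] T) := by
  let S : Submodule A ((P₀ →ₗ[A] I) × Z × (H →ₗ[A] J)) :=
    { carrier := {x | j ∘ₗ ι x.2.1 = x.1 ∘ₗ d₁ ∧ x.2.2 ∘ₗ ε = q ∘ₗ x.1}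
      add_mem' := fun {x y} hx hy ↦ by
        constructor
        · simp [comp_add, add_comp, hx.1, hy.1]
        · simp [comp_add, add_comp, hx.2, hy.2]
      zero_mem' := by simp
      smul_mem' := fun a x hx ↦ by
        constructor
        · simp [comp_smul, smul_comp, hx.1]
        · simp [comp_smul, smul_comp, hx.2] }
  have hdd : d₁ ∘ₗ d₂ = 0 := hd.linearMap_comp_eq_zero
  have hed : ε ∘ₗ d₁ = 0 := hd'.linearMap_comp_eq_zero
  have hqj : q ∘ₗ j = 0 := hjq.linearMap_comp_eq_zero
  refine ⟨equivOfKerEq (π ∘ₗ fst A Z (H →ₗ[A] J) ∘ₗ snd A (P₀ →ₗ[A] I) _ ∘ₗ S.subtype)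
    (Ψ ∘ₗ snd A Z (H →ₗ[A] J) ∘ₗ snd A (P₀ →ₗ[A] I) _ ∘ₗ S.subtype) ?_ ?_ ?_⟩
  · refine hπ.comp (g := π) (f := fun x : S ↦ x.1.2.1) fun z ↦ ?_
    have hz := (hι _).1 ⟨z, rfl⟩
    obtain ⟨φ, hφ⟩ : ∃ φ : P₀ →ₗ[A] I, φ ∘ₗ d₁ = j ∘ₗ ι z := by
      obtain ⟨φ, hφ⟩ := hI.extension_property (d₁.ker.liftQ d₁ le_rfl)
        (ker_eq_bot.1 (Submodule.ker_liftQ_eq_bot' _ _ rfl)) (d₁.ker.liftQ (j ∘ₗ ι z) (by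
          rw [hd.linearMap_ker_eq, range_le_ker_iff, comp_assoc, hz, comp_zero]))
      exact ⟨φ, LinearMap.ext fun x ↦ LinearMap.congr_fun hφ (Submodule.Quotient.mk x)⟩
    obtain ⟨θ, hθ⟩ := exists_comp_eq_of_ker_le hε (q ∘ₗ φ) (by
      rw [hd'.linearMap_ker_eq, range_le_ker_iff, comp_assoc, hφ, ← comp_assoc, hqj, zero_comp])
    exact ⟨(⟨(φ, z, θ), hφ.symm, hθ⟩ : S), rfl⟩
  · refine hΨ.comp (g := Ψ) (f := fun x : S ↦ x.1.2.2) fun θ ↦ ?_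
    obtain ⟨φ, hφ⟩ := Module.projective_lifting_property q (θ ∘ₗ ε) hq
    obtain ⟨c, hc⟩ := exists_comp_eq_of_range_le hj (φ ∘ₗ d₁) (by
      rw [← hjq.linearMap_ker_eq, range_le_ker_iff, ← comp_assoc, hφ, comp_assoc, hed, comp_zero])
    obtain ⟨z, rfl⟩ := (hι c).2 (by
      rw [← cancel_left hj, ← comp_assoc, hc, comp_assoc, hdd, comp_zero, comp_zero])
    exact ⟨(⟨(φ, z, θ), hc, hφ.symm⟩ : S), rfl⟩
  · ext ⟨⟨φ, z, θ⟩, h₁, h₂⟩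
    dsimp at h₁ h₂
    simp only [mem_ker, coe_comp, Function.comp_apply, Submodule.subtype_apply, snd_apply,
      fst_apply, hπ₀, hΨ₀]
    constructor
    · rintro ⟨χ, hχ⟩
      obtain ⟨ψ, hψ⟩ := exists_comp_eq_of_ker_le hε (φ - j ∘ₗ χ) (by
        rw [hd'.linearMap_ker_eq, range_le_ker_iff, sub_comp, comp_assoc, hχ, h₁, sub_self])
      refine ⟨ψ, ?_⟩
      rw [← cancel_right hε, comp_assoc, hψ, comp_sub, ← comp_assoc, hqj, zero_comp, sub_zero, h₂]
    · rintro ⟨ψ, hψ⟩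
      obtain ⟨χ, hχ⟩ := exists_comp_eq_of_range_le hj (φ - ψ ∘ₗ ε) (by
        rw [← hjq.linearMap_ker_eq, range_le_ker_iff, comp_sub, ← comp_assoc, hψ, h₂, sub_self])
      refine ⟨χ, ?_⟩
      rw [← cancel_left hj, ← comp_assoc, hχ, sub_comp, comp_assoc, hed, comp_zero, sub_zero, h₁]

end

section FractionQuotient

variable (A : Type*) [CommRing A]

/-- The quotient `Frac(A) / A`. -/
abbrev FractionRing.Quotient : Type _ :=
  FractionRing A ⧸ (Algebra.linearMap A (FractionRing A)).range

namespace FractionRing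

/-- The projection of the fraction field onto `Frac(A) / A`. -/
abbrev toQuotient : FractionRing A →ₗ[A] FractionRing.Quotient A := Submodule.mkQ _

lemma exact_toQuotient : Function.Exact (Algebra.linearMap A (FractionRing A)) (toQuotient A) :=
  LinearMap.exact_iff.2 (Submodule.ker_mkQ _)

lemma toQuotient_surjective : Function.Surjective (toQuotient A) := Submodule.mkQ_surjective _

variable {A}

lemma toQuotient_eq_zero_iff {x : FractionRing A} :
    toQuotient A x = 0 ↔ ∃ a, algebraMap A (FractionRing A) a = x :=
  exact_toQuotient A x

variable (A) in
lemma isTorsion_quotient : Module.IsTorsion A (FractionRing.Quotient A) := by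
  intro x
  obtain ⟨x, rfl⟩ := toQuotient_surjective A x
  obtain ⟨⟨a, s⟩, h⟩ := IsLocalization.surj (nonZeroDivisors A) x
  refine ⟨s, ?_⟩
  rw [Submonoid.smul_def, ← map_smul, toQuotient_eq_zero_iff]
  exact ⟨a, by rw [← h, Algebra.smul_def, mul_comm]⟩

variable {H : Type*} [AddCommGroup H] [Module A H]

lemma exists_smul_hom_quotient_eq_zero [Module.Finite A H] (φ : H →ₗ[A] FractionRing.Quotient A) :
    ∃ a ∈ nonZeroDivisors A, a • φ = 0 := by
  have hφ : Module.IsTorsion A φ.range := by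
    intro x
    obtain ⟨a, ha⟩ := @isTorsion_quotient A _ x
    exact ⟨a, Subtype.ext ha⟩
  obtain ⟨a, ha, ha'⟩ := Submodule.annihilator_top_inter_nonZeroDivisors hφ
  refine ⟨a, ha', LinearMap.ext fun x ↦ ?_⟩
  simpa using congrArg Subtype.val (Submodule.mem_annihilator.1 ha ⟨φ x, x, rfl⟩ trivial)

variable [IsDomain A]

lemma exists_smul_eq {a : A} (ha : a ≠ 0) (y : FractionRing A) : ∃ x, a • x = y := by
  have : algebraMap A (FractionRing A) a ≠ 0 := by simpa
  exact ⟨y / algebraMap A _ a, by rw [Algebra.smul_def, mul_div_cancel₀ _ this]⟩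

lemma quotient_exists_smul_eq {a : A} (ha : a ≠ 0) (y : FractionRing.Quotient A) :
    ∃ x, a • x = y := by
  obtain ⟨y, rfl⟩ := toQuotient_surjective A y
  obtain ⟨x, rfl⟩ := exists_smul_eq ha y
  exact ⟨toQuotient A x, (map_smul _ _ _).symm⟩

lemma hom_eq_zero_of_isTorsion (hH : Module.IsTorsion A H) (φ : H →ₗ[A] FractionRing A) :
    φ = 0 := by
  ext x
  obtain ⟨a, ha⟩ := @hH x
  have h : (a : A) • φ x = 0 := by rw [← map_smul, ← Submonoid.smul_def, ha, map_zero]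
  simpa [nonZeroDivisors.ne_zero a.2] using h

lemma nonempty_quotient_span_hom_equiv {a : A} (ha : a ≠ 0) :
    Nonempty (((A ⧸ Submodule.span A {a}) →ₗ[A] FractionRing.Quotient A) ≃ₗ[A]
      A ⧸ Submodule.span A {a}) := by
  have ha' : algebraMap A (FractionRing A) a ≠ 0 := by simpa
  let M := A ⧸ Submodule.span A {a}
  let ev : (M →ₗ[A] FractionRing.Quotient A) →ₗ[A] FractionRing.Quotient A :=
    LinearMap.applyₗ (Submodule.Quotient.mk 1 : M)
  have hev : Function.Injective ev := fun f g h ↦ by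
    ext
    exact h
  let h : A →ₗ[A] FractionRing.Quotient A :=
    toQuotient A ∘ₗ LinearMap.toSpanSingleton A _ (algebraMap A (FractionRing A) a)⁻¹
  have hh (x : A) : h x = toQuotient A (algebraMap A _ x / algebraMap A _ a) := by
    rw [div_eq_mul_inv, ← Algebra.smul_def]
    rfl
  obtain ⟨g, hg⟩ := LinearMap.exists_comp_eq_of_range_le hev h (by
    rintro _ ⟨x, rfl⟩
    have hx : LinearMap.toSpanSingleton A _ (h x) a = 0 := by
      rw [LinearMap.toSpanSingleton_apply, hh, ← map_smul, toQuotient_eq_zero_iff]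
      exact ⟨x, by rw [Algebra.smul_def, mul_div_cancel₀ _ ha']⟩
    exact ⟨Submodule.liftQSpanSingleton a _ hx,
      (Submodule.liftQSpanSingleton_apply _ _ hx 1).trans (one_smul _ _)⟩)
  refine ⟨LinearMap.equivOfKerEq g (Submodule.mkQ _) (fun f ↦ ?_) (Submodule.mkQ_surjective _) ?_⟩
  · obtain ⟨u, hu⟩ := toQuotient_surjective A (ev f)
    obtain ⟨x, hx⟩ := toQuotient_eq_zero_iff.1 (show toQuotient A (a • u) = 0 by
      rw [map_smul, hu, LinearMap.applyₗ_apply_apply, ← map_smul, ← Submodule.Quotient.mk_smul,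
        smul_eq_mul, mul_one,
        (Submodule.Quotient.mk_eq_zero _).2 (Submodule.mem_span_singleton_self a), map_zero])
    refine ⟨x, hev ((LinearMap.congr_fun hg x).trans ?_)⟩
    rw [hh, hx, Algebra.smul_def, mul_div_cancel_left₀ _ ha', hu]
  · rw [← LinearMap.ker_comp_of_ker_eq_bot g (LinearMap.ker_eq_bot.2 hev), hg]
    ext x
    rw [Submodule.ker_mkQ, LinearMap.mem_ker, hh, toQuotient_eq_zero_iff,
      Submodule.mem_span_singleton]
    refine exists_congr fun b ↦ ?_
    rw [eq_div_iff ha', ← map_mul, (IsFractionRing.injective A (FractionRing A)).eq_iff,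
      smul_eq_mul]

lemma nonempty_hom_quotient_equiv [IsPrincipalIdealRing A] [Module.Finite A H]
    (hH : Module.IsTorsion A H) : Nonempty ((H →ₗ[A] FractionRing.Quotient A) ≃ₗ[A] H) := by
  classical
  obtain ⟨ι, _, p, hp, e, ⟨f⟩⟩ := Module.equiv_directSum_of_isTorsion hH
  have g (i : ι) := (nonempty_quotient_span_hom_equiv (pow_ne_zero (e i) (hp i).ne_zero)).some
  let f' := f ≪≫ₗ DirectSum.linearEquivFunOnFintype A ι _
  exact ⟨f'.congrLeft _ A ≪≫ₗ (LinearMap.lsum A _ A).symm ≪≫ₗ LinearEquiv.piCongrRight g ≪≫ₗ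
    f'.symm⟩

end FractionRing

end FractionQuotient

section Resolution

universe u

variable {A : Type u} [CommRing A] {H : ModuleCat.{u} A} (P : ProjectiveResolution H)

lemma CategoryTheory.ProjectiveResolution.function_exact_d_d :
    Function.Exact (P.complex.d 2 1).hom (P.complex.d 1 0).hom :=
  (ShortComplex.ShortExact.moduleCat_exact_iff_function_exact _).1 (P.exact_succ 0)

/-- The augmentation map of a projective resolution. -/
noncomputable def CategoryTheory.ProjectiveResolution.augmentation : P.complex.X 0 ⟶ H :=
  P.π.f 0

lemma CategoryTheory.ProjectiveResolution.function_exact_d_augmentation :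
    Function.Exact (P.complex.d 1 0).hom P.augmentation.hom :=
  (ShortComplex.ShortExact.moduleCat_exact_iff_function_exact
    (ShortComplex.mk (P.complex.d 1 0) (P.π.f 0) P.complex_d_comp_π_f_zero)).1
    (ShortComplex.exact_of_g_is_cokernel _ P.isColimitCokernelCofork)

lemma CategoryTheory.ProjectiveResolution.augmentation_surjective :
    Function.Surjective P.augmentation.hom :=
  (ModuleCat.epi_iff_surjective _).1 (inferInstanceAs (Epi (P.π.f 0)))

end Resolution

section

universe u
variable (A : Type u) [CommRing A]

namespace FractionRing

open Limits

/-- The short exact sequence `0 ⟶ A ⟶ Frac(A) ⟶ Frac(A) / A ⟶ 0`. -/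
noncomputable abbrev shortComplex : ShortComplex (ModuleCat.{u} A) :=
  ShortComplex.mk (ModuleCat.ofHom (Algebra.linearMap A (FractionRing A)))
    (ModuleCat.ofHom (toQuotient A)) (by
      rw [← ModuleCat.ofHom_comp, (exact_toQuotient A).linearMap_comp_eq_zero]
      rfl)

lemma shortExact_shortComplex [IsDomain A] : (shortComplex A).ShortExact where
  exact := (ShortComplex.ShortExact.moduleCat_exact_iff_function_exact _).2 (exact_toQuotient A)
  mono_f := (ModuleCat.mono_iff_injective _).2 (IsFractionRing.injective A (FractionRing A))
  epi_g := (ModuleCat.epi_iff_surjective _).2 (toQuotient_surjective A)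

variable [IsDomain A] [IsPrincipalIdealRing A]

lemma baer : Module.Baer A (FractionRing A) :=
  Module.Baer.of_forall_exists_smul_eq fun _ ↦ exists_smul_eq

instance : Injective (ModuleCat.of A (FractionRing A)) :=
  have := (baer A).injective
  Module.injective_object_of_injective_module _ _

instance : Injective (ModuleCat.of A (FractionRing.Quotient A)) :=
  have : Module.Injective A (FractionRing.Quotient A) :=
    (Module.Baer.of_forall_exists_smul_eq fun _ ↦ quotient_exists_smul_eq).injective
  Module.injective_object_of_injective_module _ _

end FractionRing

lemma nonempty_Ext_one_equiv [IsDomain A] [IsPrincipalIdealRing A] (H : ModuleCat.{u} A)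
    {T : Type*} [AddCommGroup T] [Module A T]
    (Ψ : (H →ₗ[A] FractionRing.Quotient A) →ₗ[A] T) (hΨ : Function.Surjective Ψ)
    (hΨ₀ : ∀ θ, Ψ θ = 0 ↔ ∃ ψ, FractionRing.toQuotient A ∘ₗ ψ = θ) :
    Nonempty (((_root_.Ext A (ModuleCat.{u} A) 1).obj (Opposite.op H)).obj (ModuleCat.of A A) ≃ₗ[A]
      T) := by
  let P := projectiveResolution H
  let K := P.complex.linearYonedaObj A (ModuleCat.of A A)
  have : Module.Projective A (P.complex.X 0) :=
    (IsProjective.iff_projective _).2 (P.projective 0)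
  let h : (P.complex.X 1 ⟶ ModuleCat.of A A) ≃ₗ[A] (P.complex.X 1 →ₗ[A] A) :=
    ModuleCat.homLinearEquiv
  let ι : K.cycles 1 →ₗ[A] (P.complex.X 1 →ₗ[A] A) := h.toLinearMap ∘ₗ (K.iCycles 1).hom
  have hι_inj : Function.Injective ι :=
    h.injective.comp
      ((ModuleCat.mono_iff_injective (K.iCycles 1)).1 inferInstance)
  suffices Nonempty (K.homology 1 ≃ₗ[A] T) from
    this.map fun e ↦ (P.isoExt 1 _).toLinearEquiv ≪≫ₗ e
  refine nonempty_linearEquiv_of_resolution P.function_exact_d_d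
    P.function_exact_d_augmentation P.augmentation_surjective (FractionRing.baer A)
    (IsFractionRing.injective A (FractionRing A)) (FractionRing.exact_toQuotient A)
    (FractionRing.toQuotient_surjective A) ι (fun c ↦ ?_) (K.homologyπ 1).hom
    ((ModuleCat.epi_iff_surjective (K.homologyπ 1)).1 inferInstance) (fun z ↦ ?_) Ψ hΨ hΨ₀
  · have ex := (ShortComplex.ShortExact.moduleCat_exact_iff_function_exact
      (ShortComplex.mk (K.iCycles 1) (K.d 1 2) (by simp))).1
        (ShortComplex.exact_of_f_is_kernel _ (K.cyclesIsKernel 1 2 (by simp)))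
    have h := ex (ModuleCat.ofHom c)
    constructor
    · rintro ⟨z, rfl⟩
      exact congrArg ModuleCat.Hom.hom (h.2 ⟨z, rfl⟩)
    · intro hc
      obtain ⟨z, hz⟩ := h.1 (ModuleCat.hom_ext hc)
      exact ⟨z, congrArg ModuleCat.Hom.hom hz⟩
  · have ex := (ShortComplex.ShortExact.moduleCat_exact_iff_function_exact
      (ShortComplex.mk (K.toCycles 0 1) (K.homologyπ 1) (by simp))).1
        (ShortComplex.exact_of_g_is_cokernel _ (K.homologyIsCokernel 0 1 (by simp)))
    have h := ex z
    have key (χ : P.complex.X 0 ⟶ ModuleCat.of A A) :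
        ι ((K.toCycles 0 1).hom χ) = χ.hom ∘ₗ (P.complex.d 1 0).hom :=
      congrArg ModuleCat.Hom.hom (LinearMap.congr_fun
        (congrArg ModuleCat.Hom.hom (K.toCycles_i 0 1)) χ)
    refine h.trans ⟨?_, ?_⟩
    · rintro ⟨χ, rfl⟩
      exact ⟨χ.hom, (key χ).symm⟩
    · rintro ⟨χ, hχ⟩
      exact ⟨ModuleCat.ofHom χ, hι_inj ((key _).trans hχ)⟩

end

/-- An `A`-linear equivalence preserves dimensions over any base ring `K` of `A`. -/
lemma LinearEquiv.finrank_restrictScalars_eq {A M N : Type*} [CommRing A] [AddCommGroup M]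
    [Module A M] [AddCommGroup N] [Module A N] (e : M ≃ₗ[A] N) (K : Type*) [CommRing K]
    [Algebra K A] :
    Module.finrank K (RestrictScalars K A M) = Module.finrank K (RestrictScalars K A N) :=
  let e' : RestrictScalars K A M ≃+ RestrictScalars K A N := e.toAddEquiv
  (e'.toLinearEquiv fun c x ↦ e.map_smul (algebraMap K A c) x).finrank_eq

section HyperExt

open DerivedCategory

lemma HomologicalComplex.homologyMap_smul_comp {A : Type*} [CommRing A]
    (C : CochainComplex (ModuleCat A) ℤ) (r : A) (m : ℤ) {M : ModuleCat A} (f : C.homology m ⟶ M) :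
    homologyMap (r • 𝟙 C) m ≫ f = r • f := by
  have h : homologyMap (r • 𝟙 C) m = r • 𝟙 (C.homology m) :=
    (ShortComplex.homologyMap_smul (𝟙 (C.sc m)) r).trans
      (congrArg (r • ·) (ShortComplex.homologyMap_id _))
  rw [h, Linear.smul_comp, Category.id_comp]

variable (k' : Type) [Field k'] [HasDerivedCategory (ModuleCat (PowerSeries k'))]

variable (C : CochainComplex (ModuleCat (PowerSeries k')) ℤ) (n : ℤ)

/-- The embedding of `O_D` into its fraction field, in the derived category. -/
noncomputable def toFractionRing :
    Q.obj ((CochainComplex.singleFunctor (ModuleCat (PowerSeries k')) 0).obj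
        (ModuleCat.of (PowerSeries k') (PowerSeries k'))) ⟶
      Q.obj ((HomologicalComplex.single (ModuleCat (PowerSeries k')) (.up ℤ) 0).obj
        (ModuleCat.of (PowerSeries k') (FractionRing (PowerSeries k')))) :=
  Q.map ((HomologicalComplex.single (ModuleCat (PowerSeries k')) (.up ℤ) 0).map
    (FractionRing.shortComplex (PowerSeries k')).f)

/-- The extension class of `0 ⟶ O_D ⟶ Frac ⟶ Frac / O_D ⟶ 0`. -/
noncomputable def fractionRingδ :
    Q.obj ((HomologicalComplex.single (ModuleCat (PowerSeries k')) (.up ℤ) 0).obj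
        (ModuleCat.of (PowerSeries k') (FractionRing.Quotient (PowerSeries k')))) ⟶
    (Q.obj ((CochainComplex.singleFunctor (ModuleCat (PowerSeries k')) 0).obj
        (ModuleCat.of (PowerSeries k') (PowerSeries k'))))⟦(1 : ℤ)⟧ :=
  triangleOfSESδ ((FractionRing.shortExact_shortComplex (PowerSeries k')).map_of_exact
    (HomologicalComplex.single _ (.up ℤ) 0))

lemma fractionRing_distinguished :
    Pretriangulated.Triangle.mk (toFractionRing k')
      (Q.map ((HomologicalComplex.single (ModuleCat (PowerSeries k')) (.up ℤ) 0).map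
        (FractionRing.shortComplex (PowerSeries k')).g)) (fractionRingδ k') ∈ distTriang _ :=
  triangleOfSES_distinguished ((FractionRing.shortExact_shortComplex (PowerSeries k')).map_of_exact
    (HomologicalComplex.single _ (.up ℤ) 0))

/-- The connecting homomorphism `Hom(H^{1-n}(C), Frac / O_D) ⟶ Ext^n(C, O_D)`. -/
noncomputable def hyperExtConnecting :
    (C.homology (1 - n) →ₗ[PowerSeries k'] FractionRing.Quotient (PowerSeries k'))
      →ₗ[PowerSeries k'] hyperExt k' C n where
  toFun φ := connectingHom C (a := n - 1) (by lia) (by lia) (fractionRingδ k') (ModuleCat.ofHom φ)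
  map_add' φ ψ := (connectingHom C (a := n - 1) (by lia) (by lia) (fractionRingδ k')).map_add
    (ModuleCat.ofHom φ) (ModuleCat.ofHom ψ)
  map_smul' r φ :=
    (congrArg (connectingHom C (a := n - 1) (by lia) (by lia) (fractionRingδ k'))
      (HomologicalComplex.homologyMap_smul_comp C r (1 - n) (ModuleCat.ofHom φ)).symm).trans
    (connectingHom_comp_left C _ _ (r • 𝟙 C) (ModuleCat.ofHom φ))

lemma hyperExtConnecting_eq_zero_iff
    (φ : C.homology (1 - n) →ₗ[PowerSeries k'] FractionRing.Quotient (PowerSeries k')) :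
    hyperExtConnecting k' C n φ = 0 ↔ ∃ ψ, FractionRing.toQuotient (PowerSeries k') ∘ₗ ψ = φ := by
  refine (connectingHom_eq_zero_iff C (m := 1 - n) (a := n - 1) (by lia) (by lia)
    (fractionRing_distinguished k') _).trans ⟨?_, ?_⟩
  · rintro ⟨ψ, hψ⟩
    exact ⟨ψ.hom, congrArg ModuleCat.Hom.hom hψ⟩
  · rintro ⟨ψ, rfl⟩
    exact ⟨ModuleCat.ofHom ψ, rfl⟩

lemma mem_range_hyperExtConnecting_iff (x : hyperExt k' C n) :
    x ∈ (hyperExtConnecting k' C n).range ↔ x ≫ (toFractionRing k')⟦n⟧' = 0 := by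
  refine Iff.trans ⟨?_, ?_⟩ (exists_connectingHom_eq_iff C (m := 1 - n) (a := n - 1) (by lia)
    (by lia) (fractionRing_distinguished k') x)
  · rintro ⟨φ, rfl⟩
    exact ⟨_, rfl⟩
  · rintro ⟨φ, rfl⟩
    exact ⟨φ.hom, rfl⟩

lemma hom_single_fractionRing_eq_zero_of_smul_eq_zero {r : PowerSeries k'}
    (hr : r ∈ nonZeroDivisors (PowerSeries k'))
    (y : Q.obj C ⟶ (Q.obj ((HomologicalComplex.single (ModuleCat (PowerSeries k')) (.up ℤ) 0).obj
        (ModuleCat.of (PowerSeries k') (FractionRing (PowerSeries k')))))⟦n⟧)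
    (hy : Q.map (r • 𝟙 C) ≫ y = 0) : y = 0 := by
  have hn : n + -n = 0 := by lia
  apply (shiftedHomologyHom_bijective C hn _).1
  have h := shiftedHomologyHom_comp_left (r • 𝟙 C) hn y
  rw [hy, map_zero, HomologicalComplex.homologyMap_smul_comp] at h
  rw [map_zero]
  ext x
  have hx := LinearMap.congr_fun (congrArg ModuleCat.Hom.hom h) x
  simpa [nonZeroDivisors.ne_zero hr] using hx.symm

lemma range_hyperExtConnecting [Module.Finite (PowerSeries k') (C.homology (1 - n))] :
    (hyperExtConnecting k' C n).range = Submodule.torsion (PowerSeries k') (hyperExt k' C n) := by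
  ext x
  constructor
  · rintro ⟨φ, rfl⟩
    obtain ⟨a, ha, h⟩ := FractionRing.exists_smul_hom_quotient_eq_zero φ
    refine ⟨⟨a, ha⟩, ?_⟩
    rw [Submonoid.smul_def, ← map_smul, h, map_zero]
  · rintro ⟨a, ha⟩
    rw [mem_range_hyperExtConnecting_iff]
    refine hom_single_fractionRing_eq_zero_of_smul_eq_zero k' C n a.2 _ ?_
    rw [← Category.assoc]
    exact (congrArg (fun z : hyperExt k' C n ↦ z ≫ (toFractionRing k')⟦n⟧') ha).trans
      Limits.zero_comp

lemma range_hyperExtConnecting_eq_top (h : Module.IsTorsion (PowerSeries k') (C.homology (-n))) :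
    LinearMap.range (hyperExtConnecting k' C n) = ⊤ := by
  refine eq_top_iff.2 fun x _ ↦ (mem_range_hyperExtConnecting_iff k' C n x).2 ?_
  apply (shiftedHomologyHom_bijective C (show n + -n = 0 by lia) _).1
  rw [map_zero]
  exact ModuleCat.hom_ext (FractionRing.hom_eq_zero_of_isTorsion h _)

end HyperExt

theorem statement7 (k' : Type) [Field k']
    [HasDerivedCategory (ModuleCat (PowerSeries k'))]
    (C : CochainComplex (ModuleCat (PowerSeries k')) ℤ)
    -- `C = Lβ^*E` is bounded above ...
    (hbdd : ∃ Nb : ℤ, ∀ i : ℤ, Nb < i → Limits.IsZero (C.X i))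
    -- ... with finitely generated (coherent) cohomology modules `L^iβ^*E`:
    (hfg : ∀ i : ℤ, Module.Finite (PowerSeries k') ↥(C.homology i))
    (n : ℤ) :
    -- canonical isomorphism `Ext^1(L^{1-n}β^*E, O) ≅ Ext^n(Lβ^*E, O)_tors`:
    Nonempty
      (↥(((_root_.Ext (PowerSeries k') (ModuleCat (PowerSeries k')) 1).obj
            (Opposite.op (C.homology (1 - n)))).obj
          (ModuleCat.of (PowerSeries k') (PowerSeries k'))) ≃ₗ[PowerSeries k']
        ↥(Submodule.torsion (PowerSeries k') (hyperExt k' C n))) ∧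
    -- if `L^{1-n}β^*E` is torsion, the `k'`-dimension of `Ext^n(Lβ^*E, O)_tors`
    -- equals `dim_{k'} L^{1-n}β^*E`:
    (Module.IsTorsion (PowerSeries k') ↥(C.homology (1 - n)) →
      Module.finrank k' (RestrictScalars k' (PowerSeries k')
          ↥(Submodule.torsion (PowerSeries k') (hyperExt k' C n))) =
        Module.finrank k' (RestrictScalars k' (PowerSeries k') ↥(C.homology (1 - n)))) ∧
    -- if additionally `L^{-n}β^*E` is torsion, then `Ext^n(Lβ^*E, O)` is all torsion:
    (Module.IsTorsion (PowerSeries k') ↥(C.homology (1 - n)) →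
      Module.IsTorsion (PowerSeries k') ↥(C.homology (-n)) →
      Submodule.torsion (PowerSeries k') (hyperExt k' C n) = ⊤) := by
  have := hfg (1 - n)
  have hrange := range_hyperExtConnecting k' C n
  let Ψ := (LinearEquiv.ofEq _ _ hrange).toLinearMap ∘ₗ (hyperExtConnecting k' C n).rangeRestrict
  have hΨ : Function.Surjective Ψ :=
    (LinearEquiv.ofEq _ _ hrange).surjective.comp (LinearMap.surjective_rangeRestrict _)
  have hΨ₀ (φ) : Ψ φ = 0 ↔ ∃ ψ, FractionRing.toQuotient _ ∘ₗ ψ = φ :=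
    Subtype.ext_iff.trans (hyperExtConnecting_eq_zero_iff k' C n φ)
  refine ⟨nonempty_Ext_one_equiv _ _ Ψ hΨ hΨ₀, fun h ↦ ?_, fun _ h ↦ ?_⟩
  · have hΨ_inj : Function.Injective Ψ := (injective_iff_map_eq_zero Ψ).2 fun φ hφ ↦ by
      obtain ⟨ψ, rfl⟩ := (hΨ₀ φ).1 hφ
      rw [FractionRing.hom_eq_zero_of_isTorsion h ψ, LinearMap.comp_zero]
    obtain ⟨e⟩ := FractionRing.nonempty_hom_quotient_equiv h
    exact ((LinearEquiv.ofBijective Ψ ⟨hΨ_inj, hΨ⟩).symm ≪≫ₗ e).finrank_restrictScalars_eq k'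
  · rw [← hrange, range_hyperExtConnecting_eq_top k' C n h]
end

section
/- Let A be a ring such that μ_{ℓ,A} ≅ ℤ/ℓ is étale, ℓ > 1, n > 0, m = ℓ(n+1) − 1, R = A[t]/(t^{n+1}) and S = R[u]/(u^ℓ − t). If f is a graded (μ_ℓ-equivariant) R-algebra automorphism of S, then f(u) = ζu + au^{ℓn+1} for some ζ ∈ μ_ℓ(A) and a ∈ A. For n = 0 (so S = A[u]/(u^ℓ)), every such automorphism is of the form f(u) = bu with b ∈ A^*. -/
set_option synthInstance.maxHeartbeats 400000
set_option maxHeartbeats 800000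

open MvPolynomial

noncomputable section

/-- Degree-`i` piece (ℤ/ℓ-grading, `u = X 1` of degree 1, `t = X 0` of degree 0)
of the polynomial ring `A[t,u]`. -/
def Bpiece (A : Type) [CommRing A] (ℓ : ℕ) (i : ZMod ℓ) :
    Submodule A (MvPolynomial (Fin 2) A) where
  carrier := {p | ∀ m : Fin 2 →₀ ℕ, ((m 1 : ZMod ℓ) ≠ i) → MvPolynomial.coeff m p = 0}
  add_mem' := by
    intro a b ha hb m hm
    simp [MvPolynomial.coeff_add, ha m hm, hb m hm]
  zero_mem' := by
    intro m hm
    simp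
  smul_mem' := by
    intro c p hp m hm
    simp [MvPolynomial.coeff_smul, hp m hm]

end

noncomputable section

variable (A : Type) [CommRing A] (ℓ n : ℕ)

/-- The ideal `(t^{n+1}, u^ℓ - t) ⊆ A[t,u]`, presenting `S = (A[t]/(t^{n+1}))[u]/(u^ℓ-t)`. -/
def discIdeal : Ideal (MvPolynomial (Fin 2) A) :=
  Ideal.span {(X 0 : MvPolynomial (Fin 2) A) ^ (n + 1),
    (X 1 : MvPolynomial (Fin 2) A) ^ ℓ - X 0}

/-- `S = (A[t]/(t^{n+1}))[u]/(u^ℓ - t)`, the standard cover of the truncated twisted disc. -/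
abbrev TwDiscN : Type := MvPolynomial (Fin 2) A ⧸ discIdeal A ℓ n

/-- The class of `t` in `S`. -/
def tS : TwDiscN A ℓ n := Ideal.Quotient.mk (discIdeal A ℓ n) (X 0)

/-- The class of `u` in `S`. -/
def uS : TwDiscN A ℓ n := Ideal.Quotient.mk (discIdeal A ℓ n) (X 1)

/-- The degree-`i` piece of the induced ℤ/ℓ-grading on `S` (`u` has degree 1). -/
def SpieceN (i : ZMod ℓ) : Submodule A (TwDiscN A ℓ n) :=
  Submodule.map ((discIdeal A ℓ n).mkQ.restrictScalars A) (Bpiece A ℓ i)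

end

namespace TwDiscN

variable {A : Type} [CommRing A] {ℓ n : ℕ}

theorem uS_pow : uS A ℓ n ^ ℓ = tS A ℓ n := by
  unfold uS tS
  rw [← map_pow, Ideal.Quotient.mk_eq_mk_iff_sub_mem]
  exact Ideal.subset_span (by simp)

theorem tS_pow : tS A ℓ n ^ (n + 1) = 0 := by
  unfold tS
  rw [← map_pow, Ideal.Quotient.eq_zero_iff_mem]
  exact Ideal.subset_span (by simp)

/-- The substitution `t ↦ X ^ ℓ`, `u ↦ X` from `A[t,u]` to `A[X]`. -/
noncomputable def toPoly (A : Type) [CommRing A] (ℓ : ℕ) : MvPolynomial (Fin 2) A →ₐ[A] Polynomial A :=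
  MvPolynomial.aeval ![Polynomial.X ^ ℓ, Polynomial.X]

theorem aeval_toPoly (q : MvPolynomial (Fin 2) A) :
    Polynomial.aeval (uS A ℓ n) (toPoly A ℓ q) = Ideal.Quotient.mk (discIdeal A ℓ n) q := by
  have h : (Polynomial.aeval (uS A ℓ n)).comp (toPoly A ℓ) =
      Ideal.Quotient.mkₐ A (discIdeal A ℓ n) := by
    apply MvPolynomial.algHom_ext
    intro i
    fin_cases i
    · simpa [toPoly] using! uS_pow
    · simp [toPoly, uS]
  exact DFunLike.congr_fun h q

theorem exists_aeval_uS (y : TwDiscN A ℓ n) :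
    ∃ p : Polynomial A, Polynomial.aeval (uS A ℓ n) p = y := by
  obtain ⟨q, rfl⟩ := Ideal.Quotient.mk_surjective y
  exact ⟨toPoly A ℓ q, aeval_toPoly q⟩

theorem X_pow_dvd_toPoly {q : MvPolynomial (Fin 2) A} (hq : q ∈ discIdeal A ℓ n) :
    Polynomial.X ^ (ℓ * (n + 1)) ∣ toPoly A ℓ q := by
  have h : discIdeal A ℓ n ≤
      (Ideal.span {(Polynomial.X : Polynomial A) ^ (ℓ * (n + 1))}).comap (toPoly A ℓ) := by
    refine Ideal.span_le.2 ?_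
    rintro x (rfl | rfl)
    · simp [toPoly, pow_mul]
    · simp [toPoly]
  exact Ideal.mem_span_singleton.1 (h hq)

theorem X_pow_dvd_of_aeval_eq_zero {p : Polynomial A}
    (hp : Polynomial.aeval (uS A ℓ n) p = 0) : Polynomial.X ^ (ℓ * (n + 1)) ∣ p := by
  have h1 : toPoly A ℓ (Polynomial.aeval (X 1) p) = p := by
    rw [← Polynomial.aeval_algHom_apply]
    simp [toPoly]
  have h2 : Ideal.Quotient.mk (discIdeal A ℓ n) (Polynomial.aeval (X 1) p) = 0 := by
    rw [← aeval_toPoly, h1, hp]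
  rw [← h1]
  exact X_pow_dvd_toPoly (Ideal.Quotient.eq_zero_iff_mem.1 h2)

theorem uS_mem_SpieceN : uS A ℓ n ∈ SpieceN A ℓ n 1 := by
  refine ⟨X 1, ?_, rfl⟩
  intro m hm
  rw [MvPolynomial.coeff_X, if_neg]
  rintro rfl
  simp at hm

theorem exists_eq_uS_mul_of_mem_SpieceN (hℓ : 1 < ℓ) {x : TwDiscN A ℓ n}
    (hx : x ∈ SpieceN A ℓ n 1) :
    ∃ g : Polynomial A, x = uS A ℓ n * Polynomial.aeval (tS A ℓ n) g := by
  obtain ⟨p, hp, rfl⟩ := hx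
  let M : Submodule A (TwDiscN A ℓ n) := LinearMap.range
    ((LinearMap.mulLeft A (uS A ℓ n)).comp (Polynomial.aeval (tS A ℓ n)).toLinearMap)
  suffices h : Ideal.Quotient.mkₐ A (discIdeal A ℓ n) p ∈ M by
    obtain ⟨g, hg⟩ := h
    exact ⟨g, hg.symm⟩
  rw [p.as_sum, map_sum]
  refine M.sum_mem fun m hm => ?_
  have hm1 : ((m 1 : ℕ) : ZMod ℓ) = (1 : ℕ) := by
    by_contra h
    exact MvPolynomial.mem_support_iff.1 hm (hp m (by simpa using h))
  rw [ZMod.natCast_eq_natCast_iff', Nat.mod_eq_of_lt hℓ] at hm1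
  have hdiv : m 1 = 1 + ℓ * (m 1 / ℓ) := by
    conv_lhs => rw [← Nat.mod_add_div (m 1) ℓ, hm1]
  refine ⟨Polynomial.monomial (m 0 + m 1 / ℓ) (coeff m p), ?_⟩
  rw [MvPolynomial.monomial_eq]
  have hu : uS A ℓ n ^ m 1 = uS A ℓ n * tS A ℓ n ^ (m 1 / ℓ) := by
    conv_lhs => rw [hdiv, pow_add, pow_mul, uS_pow, pow_one]
  have : Ideal.Quotient.mkₐ A (discIdeal A ℓ n)
      (C (coeff m p) * m.prod fun i e => X i ^ e) =
      algebraMap A (TwDiscN A ℓ n) (coeff m p) * (tS A ℓ n ^ m 0 * uS A ℓ n ^ m 1) := by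
    rw [Finsupp.prod_fintype _ _ (by simp), Fin.prod_univ_two, map_mul, map_mul, map_pow, map_pow]
    rfl
  rw [this, hu]
  simp only [LinearMap.comp_apply, AlgHom.toLinearMap_apply, LinearMap.mulLeft_apply,
    Polynomial.aeval_monomial, pow_add]
  ring

theorem X_pow_dvd_pow_sub_one (hℓ : 0 < ℓ) {g : Polynomial A}
    (h : (uS A ℓ n * Polynomial.aeval (tS A ℓ n) g) ^ ℓ = tS A ℓ n) :
    Polynomial.X ^ n ∣ g ^ ℓ - 1 := by
  have h0 : Polynomial.aeval (uS A ℓ n)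
      (Polynomial.X ^ ℓ * Polynomial.expand A ℓ (g ^ ℓ - 1)) = 0 := by
    rw [map_mul, Polynomial.expand_aeval, map_pow, Polynomial.aeval_X, uS_pow, map_sub,
      map_pow, map_one, mul_sub, mul_one, sub_eq_zero]
    conv_rhs => rw [← h, mul_pow, uS_pow]
  have h1 := X_pow_dvd_of_aeval_eq_zero h0
  rw [Polynomial.X_pow_dvd_iff] at h1 ⊢
  intro d hd
  have h2 := h1 (d * ℓ + ℓ) (by nlinarith)
  rwa [mul_comm, Polynomial.coeff_mul_X_pow, Polynomial.coeff_expand_mul hℓ] at h2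

end TwDiscN

theorem Polynomial.isCoprime_X_pow_of_isUnit_coeff_zero {A : Type*} [CommRing A] (n : ℕ)
    {q : Polynomial A} (hq : IsUnit (q.coeff 0)) : IsCoprime (Polynomial.X ^ n) q := by
  refine IsCoprime.pow_left ?_
  obtain ⟨v, hv⟩ := hq.exists_left_inv
  refine ⟨-Polynomial.C v * q.divX, Polynomial.C v, ?_⟩
  have h : Polynomial.C v * Polynomial.C (q.coeff 0) = 1 := by
    rw [← Polynomial.C_mul, hv, Polynomial.C_1]
  linear_combination h - Polynomial.C v * q.divX_mul_X_add

theorem Polynomial.X_pow_dvd_sub_C_coeff_zero {A : Type*} [CommRing A] {ℓ n : ℕ}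
    (hunit : IsUnit (ℓ : A)) {g : Polynomial A} (hζ : g.coeff 0 ^ ℓ = 1) (hℓ : ℓ ≠ 0)
    (hg : Polynomial.X ^ n ∣ g ^ ℓ - 1) :
    Polynomial.X ^ n ∣ g - Polynomial.C (g.coeff 0) := by
  have h1 : g ^ ℓ - 1 = g ^ ℓ - Polynomial.C (g.coeff 0) ^ ℓ := by
    rw [← Polynomial.C_pow, hζ, Polynomial.C_1]
  rw [h1, ← Commute.geom_sum₂_mul (Commute.all _ _)] at hg
  refine IsCoprime.dvd_of_dvd_mul_left
    (Polynomial.isCoprime_X_pow_of_isUnit_coeff_zero n ?_) hg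
  have h2 : (∑ i ∈ Finset.range ℓ,
      g ^ i * Polynomial.C (g.coeff 0) ^ (ℓ - 1 - i)).coeff 0 = ℓ * g.coeff 0 ^ (ℓ - 1) := by
    rw [Polynomial.coeff_zero_eq_eval_zero]
    simp only [Polynomial.eval_finsetSum, Polynomial.eval_mul, Polynomial.eval_pow,
      Polynomial.eval_C, ← Polynomial.coeff_zero_eq_eval_zero]
    rw [geom_sum₂_self]
  rw [h2]
  exact hunit.mul ((IsUnit.of_pow_eq_one hζ hℓ).pow _)

/-- Any graded `R`-algebra automorphism of
`S = (A[t]/(t^{n+1}))[u]/(u^ℓ - t)` satisfies `f(u) = ζu + a·u^{ℓn+1}` with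
`ζ^ℓ = 1`, for `n > 0`; for `n = 0` it satisfies `f(u) = b·u` with `b` a unit.
(The hypothesis that `μ_{ℓ,A} ≅ ℤ/ℓ` is étale is rendered as: `ℓ` is invertible in
`A` and `A` contains a primitive `ℓ`-th root of unity.) -/
theorem statement12 (A : Type) [CommRing A] (ℓ n : ℕ) (hℓ : 1 < ℓ)
    (hunit : IsUnit (ℓ : A)) (hroot : ∃ ζ₀ : A, IsPrimitiveRoot ζ₀ ℓ)
    (f : TwDiscN A ℓ n ≃ₐ[A] TwDiscN A ℓ n)
    (hft : f (tS A ℓ n) = tS A ℓ n)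
    (hgr : ∀ i : ZMod ℓ, ∀ x ∈ SpieceN A ℓ n i, f x ∈ SpieceN A ℓ n i) :
    (0 < n → ∃ ζ a : A, ζ ^ ℓ = 1 ∧
      f (uS A ℓ n) = algebraMap A (TwDiscN A ℓ n) ζ * uS A ℓ n +
        algebraMap A (TwDiscN A ℓ n) a * uS A ℓ n ^ (ℓ * n + 1)) ∧
    (n = 0 → ∃ b : A, IsUnit b ∧
      f (uS A ℓ n) = algebraMap A (TwDiscN A ℓ n) b * uS A ℓ n) := by
  obtain ⟨g, hg⟩ := TwDiscN.exists_eq_uS_mul_of_mem_SpieceN hℓ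
    (hgr 1 _ TwDiscN.uS_mem_SpieceN)
  refine ⟨fun hn => ?_, ?_⟩
  · have hdvd : Polynomial.X ^ n ∣ g ^ ℓ - 1 := by
      refine TwDiscN.X_pow_dvd_pow_sub_one (by omega) ?_
      rw [← hg, ← map_pow, TwDiscN.uS_pow, hft]
    have hζ : g.coeff 0 ^ ℓ = 1 := by
      have h := Polynomial.X_pow_dvd_iff.1 hdvd 0 hn
      simpa [Polynomial.coeff_zero_eq_eval_zero, sub_eq_zero] using h
    obtain ⟨h, hh⟩ := Polynomial.X_pow_dvd_sub_C_coeff_zero hunit hζ (by omega) hdvd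
    refine ⟨g.coeff 0, h.coeff 0, hζ, ?_⟩
    have hg' : g = Polynomial.C (g.coeff 0) +
        Polynomial.X ^ n * (h.divX * Polynomial.X + Polynomial.C (h.coeff 0)) := by
      rw [h.divX_mul_X_add, ← hh]; ring
    have he := congrArg (Polynomial.aeval (tS A ℓ n)) hg'
    simp only [map_add, map_mul, map_pow, Polynomial.aeval_X, Polynomial.aeval_C] at he
    rw [hg, he, pow_succ, pow_mul, TwDiscN.uS_pow]
    linear_combination uS A ℓ n * Polynomial.aeval (tS A ℓ n) h.divX *
      (TwDiscN.tS_pow : tS A ℓ n ^ (n + 1) = 0)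
  · rintro rfl
    have hfu : f (uS A ℓ 0) = algebraMap A (TwDiscN A ℓ 0) (g.coeff 0) * uS A ℓ 0 := by
      have ht : tS A ℓ 0 = 0 := by simpa using (TwDiscN.tS_pow : tS A ℓ 0 ^ (0 + 1) = 0)
      rw [hg, ht, ← Polynomial.coeff_zero_eq_aeval_zero', mul_comm]
    refine ⟨g.coeff 0, ?_, hfu⟩
    obtain ⟨y, hy⟩ := f.surjective (uS A ℓ 0)
    obtain ⟨p, rfl⟩ := TwDiscN.exists_aeval_uS y
    have h0 : Polynomial.aeval (uS A ℓ 0)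
        (p.comp (Polynomial.C (g.coeff 0) * Polynomial.X) - Polynomial.X) = 0 := by
      rw [map_sub, Polynomial.aeval_comp, map_mul, Polynomial.aeval_C, Polynomial.aeval_X,
        ← hfu, Polynomial.aeval_algHom_apply, hy, sub_self]
    have h1 := Polynomial.X_pow_dvd_iff.1 (TwDiscN.X_pow_dvd_of_aeval_eq_zero h0) 1 (by omega)
    rw [Polynomial.coeff_sub, Polynomial.comp_C_mul_X_coeff, Polynomial.coeff_X_one, pow_one,
      sub_eq_zero] at h1
    exact .of_mul_eq_one_right _ h1
end
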